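/- arXiv:0707.4239 — 2 statements merged into one kernel-verified Lean document; each statement's English description precedes it below -/
import Mathlib

section
/- Let M be a finite von Neumann algebra with faithful normal tracial state τ and let |||·||| be a seminorm on M. Then |||·||| satisfies |||T||| = ||| |T| ||| for all T ∈ M (gauge invariance) if and only if |||AT||| ≤ ‖A‖ · |||T||| for all A, T ∈ M, where ‖A‖ is the operator norm. -/
open scoped ComplexOrder

/-- The absolute value `|T| = (T*T)^{1/2}` of a bounded operator on a Hilbert space. -/
noncomputable def opAbs {H : Type} [NormedAddCommGroup H] [InnerProductSpace ℂ H]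
    [CompleteSpace H] (T : H →L[ℂ] H) : H →L[ℂ] H := CFC.sqrt (star T * T)

/-- `τ` is a faithful tracial state on the von Neumann algebra `M`. -/
structure IsFaithfulTracialState {H : Type} [NormedAddCommGroup H] [InnerProductSpace ℂ H]
    [CompleteSpace H] (M : VonNeumannAlgebra H) (τ : (H →L[ℂ] H) → ℂ) : Prop where
  map_add : ∀ S T, τ (S + T) = τ S + τ T
  map_smul : ∀ (c : ℂ) (T), τ (c • T) = c * τ T
  map_one : τ 1 = 1
  pos : ∀ T ∈ M, 0 ≤ τ (star T * T)
  faithful : ∀ T ∈ M, τ (star T * T) = 0 → T = 0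
  tracial : ∀ S ∈ M, ∀ T ∈ M, τ (S * T) = τ (T * S)

namespace VonNeumannAlgebra

variable {H : Type} [NormedAddCommGroup H] [InnerProductSpace ℂ H] [CompleteSpace H]
  {M : VonNeumannAlgebra H} {T : H →L[ℂ] H}

lemma mem_of_commute_imp {S : H →L[ℂ] H} (hT : T ∈ M) (h : ∀ g, Commute T g → Commute S g) :
    S ∈ M := by
  rw [← M.commutant_commutant, mem_commutant_iff]
  intro g hg
  exact (h g (mem_commutant_iff.1 hg T hT)).eq.symm

lemma smul_mem (c : ℂ) (hT : T ∈ M) : c • T ∈ M :=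
  mem_of_commute_imp hT fun _ hg ↦ hg.smul_left c

lemma sqrt_mem (hT : T ∈ M) : CFC.sqrt T ∈ M :=
  mem_of_commute_imp hT fun _ hg ↦ hg.cfcₙ_nnreal _

lemma cfc_real_mem (f : ℝ → ℝ) (hT : T ∈ M) : cfc f T ∈ M :=
  mem_of_commute_imp hT fun _ hg ↦ hg.cfc_real f

lemma opAbs_mem (hT : T ∈ M) : opAbs T ∈ M :=
  sqrt_mem (mul_mem (star_mem hT) hT)

end VonNeumannAlgebra

section OpAbs

variable {H : Type} [NormedAddCommGroup H] [InnerProductSpace ℂ H] [CompleteSpace H]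

lemma opAbs_nonneg (T : H →L[ℂ] H) : 0 ≤ opAbs T := CFC.abs_nonneg T

lemma opAbs_isSelfAdjoint (T : H →L[ℂ] H) : IsSelfAdjoint (opAbs T) :=
  (opAbs_nonneg T).isSelfAdjoint

lemma opAbs_mul_opAbs (T : H →L[ℂ] H) : opAbs T * opAbs T = star T * T := CFC.abs_mul_abs T

lemma norm_opAbs (T : H →L[ℂ] H) : ‖opAbs T‖ = ‖T‖ := CFC.norm_abs

lemma opAbs_mul (A T : H →L[ℂ] H) : opAbs (A * T) = opAbs (opAbs A * T) := by
  unfold opAbs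
  congr 1
  change _ = star (opAbs A * T) * (opAbs A * T)
  rw [star_mul, star_mul, (opAbs_isSelfAdjoint A).star_eq, mul_assoc, mul_assoc,
    ← mul_assoc (opAbs A), opAbs_mul_opAbs, mul_assoc]

lemma opAbs_unitary_mul {U : H →L[ℂ] H} (hU : U ∈ unitary (H →L[ℂ] H)) (T : H →L[ℂ] H) :
    opAbs (U * T) = opAbs T := by
  unfold opAbs
  rw [star_mul, mul_assoc, ← mul_assoc (star U), Unitary.star_mul_self_of_mem hU, one_mul]

/-- An approximate polar decomposition: `B` nearly implements `opAbs T ↦ T`, and its adjoint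
nearly implements `T ↦ opAbs T`. -/
lemma exists_approx_polar {M : VonNeumannAlgebra H} {T : H →L[ℂ] H} (hT : T ∈ M)
    {ε : ℝ} (hε : 0 < ε) :
    ∃ B ∈ M, ∃ C ∈ M, ‖B‖ ≤ 1 ∧ ‖C‖ ≤ 1 ∧ T = B * opAbs T + (ε : ℂ) • B ∧
      opAbs T = star B * T + (ε : ℂ) • C := by
  set P := opAbs T with hP
  have hP0 : 0 ≤ P := opAbs_nonneg T
  have hPM : P ∈ M := VonNeumannAlgebra.opAbs_mem hT
  have hPsa : IsSelfAdjoint P := hP0.isSelfAdjoint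
  have hspec : ∀ x ∈ spectrum ℝ P, 0 ≤ x := fun x hx ↦ spectrum_nonneg_of_nonneg hP0 hx
  set R := cfc (fun x : ℝ ↦ (x + ε)⁻¹) P with hR
  have hcont : ContinuousOn (fun x : ℝ ↦ (x + ε)⁻¹) (spectrum ℝ P) :=
    ContinuousOn.inv₀ (by fun_prop) fun x hx ↦ by linarith [hspec x hx]
  have hRM : R ∈ M := VonNeumannAlgebra.cfc_real_mem _ hPM
  have hRsa : IsSelfAdjoint R := cfc_predicate _ P
  have hRP : R * P = cfc (fun x : ℝ ↦ (x + ε)⁻¹ * x) P := by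
    rw [cfc_mul _ _ P hcont (by fun_prop), cfc_id' ℝ P]
  have hcomm : Commute R P := by
    simpa only [cfc_id' ℝ P] using! cfc_commute_cfc (fun x : ℝ ↦ (x + ε)⁻¹) (fun x ↦ x) P
  have hsplit : R * P + ε • R = 1 := by
    rw [hRP, hR, ← cfc_smul ε _ P hcont, ← cfc_add P (fun x : ℝ ↦ (x + ε)⁻¹ * x)
      (fun x : ℝ ↦ ε • (x + ε)⁻¹) (hcont.mul (by fun_prop)) (hcont.const_smul ε), ← cfc_one ℝ P]
    refine cfc_congr fun x hx ↦ ?_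
    have : x + ε ≠ 0 := by linarith [hspec x hx]
    simp only [smul_eq_mul, Pi.one_apply]
    field_simp
  have hnorm : ‖R * P‖ ≤ 1 := by
    rw [hRP]
    refine norm_cfc_le zero_le_one fun x hx ↦ ?_
    have h0 := hspec x hx
    rw [Real.norm_of_nonneg (by positivity), inv_mul_le_one₀ (by positivity)]
    linarith
  refine ⟨T * R, mul_mem hT hRM, R * P, mul_mem hRM hPM, ?_, hnorm, ?_, ?_⟩
  · have h : star (T * R) * (T * R) = star (R * P) * (R * P) := by
      calc star (T * R) * (T * R) = R * (star T * T) * R := by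
            rw [star_mul, hRsa.star_eq]; simp only [mul_assoc]
        _ = R * P * (P * R) := by rw [← opAbs_mul_opAbs]; simp only [mul_assoc, hP]
        _ = star (R * P) * (R * P) := by
            rw [star_mul, hRsa.star_eq, hPsa.star_eq, ← hcomm.eq]
    have h2 : ‖T * R‖ * ‖T * R‖ = ‖R * P‖ * ‖R * P‖ := by
      rw [← CStarRing.norm_star_mul_self, h, CStarRing.norm_star_mul_self]
    rw [mul_self_inj (norm_nonneg _) (norm_nonneg _)] at h2
    exact h2.trans_le hnorm
  · rw [Complex.coe_smul, mul_assoc, ← mul_smul_comm, ← mul_add, hsplit, mul_one]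
  · rw [Complex.coe_smul, star_mul, hRsa.star_eq, mul_assoc, ← opAbs_mul_opAbs, ← hP,
      ← mul_assoc, ← smul_mul_assoc, ← add_mul, hsplit, one_mul]

/-- A self-adjoint element is a multiple of the sum of a unitary and its adjoint. -/
lemma exists_unitary_eq_smul_add_star {M : VonNeumannAlgebra H} {S : H →L[ℂ] H} (hS : S ∈ M)
    (hsa : IsSelfAdjoint S) :
    ∃ U ∈ M, U ∈ unitary (H →L[ℂ] H) ∧ S = ((‖S‖ / 2 : ℝ) : ℂ) • (U + star U) := by
  obtain rfl | h0 := eq_or_ne S 0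
  · exact ⟨1, one_mem M, one_mem _, by simp⟩
  have hn : ‖S‖ ≠ 0 := norm_ne_zero_iff.2 h0
  have hcsa : (‖S‖⁻¹ : ℝ) • S ∈ selfAdjoint (H →L[ℂ] H) := (IsSelfAdjoint.all _).smul hsa
  have hcn : ‖(⟨_, hcsa⟩ : selfAdjoint (H →L[ℂ] H))‖ ≤ 1 := by
    rw [AddSubgroup.coe_norm, norm_smul, norm_inv, norm_norm, inv_mul_cancel₀ hn]
  have hcM : (‖S‖⁻¹ : ℝ) • S ∈ M := by
    rw [← Complex.coe_smul]; exact VonNeumannAlgebra.smul_mem _ hS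
  refine ⟨selfAdjoint.unitarySelfAddISMul ⟨_, hcsa⟩ hcn, ?_, Subtype.prop _, ?_⟩
  · exact add_mem hcM (VonNeumannAlgebra.smul_mem _
      (VonNeumannAlgebra.sqrt_mem (sub_mem (one_mem _) (pow_mem hcM 2))))
  · rw [selfAdjoint.star_coe_unitarySelfAddISMul,
      selfAdjoint.unitarySelfAddISMul_coe, add_add_sub_cancel, Complex.coe_smul, ← smul_add,
      smul_smul, ← two_smul ℝ S, smul_smul]
    field_simp
    simp

end OpAbs

/-- A seminorm on a finite von Neumann algebra is gauge invariant
(i.e. `ν T = ν (opAbs T)`) iff it is left submultiplicative with respect to the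
operator norm (i.e. `ν (A * T) ≤ ‖A‖ * ν T`). -/
theorem stmt_6 {H : Type} [NormedAddCommGroup H] [InnerProductSpace ℂ H] [CompleteSpace H]
    (M : VonNeumannAlgebra H) (τ : (H →L[ℂ] H) → ℂ) (hτ : IsFaithfulTracialState M τ)
    (ν : (H →L[ℂ] H) → ℝ)
    (hν0 : ∀ T ∈ M, 0 ≤ ν T)
    (hνadd : ∀ S ∈ M, ∀ T ∈ M, ν (S + T) ≤ ν S + ν T)
    (hνsmul : ∀ (c : ℂ), ∀ T ∈ M, ν (c • T) = ‖c‖ * ν T) :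
    (∀ T ∈ M, ν T = ν (opAbs T)) ↔ (∀ A ∈ M, ∀ T ∈ M, ν (A * T) ≤ ‖A‖ * ν T) := by
  have hsmul {c : ℂ} {T : H →L[ℂ] H} (hT : T ∈ M) : c • T ∈ M := VonNeumannAlgebra.smul_mem c hT
  constructor
  · intro h A hA T hT
    have hunit {U : H →L[ℂ] H} (hU : U ∈ M) (hU' : U ∈ unitary (H →L[ℂ] H)) :
        ν (U * T) = ν T := by
      rw [h _ (mul_mem hU hT), opAbs_unitary_mul hU', ← h T hT]
    have hP := VonNeumannAlgebra.opAbs_mem hA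
    rw [h _ (mul_mem hA hT), opAbs_mul, ← h _ (mul_mem hP hT), ← norm_opAbs A]
    obtain ⟨U, hUM, hU, hPU⟩ := exists_unitary_eq_smul_add_star hP (opAbs_isSelfAdjoint A)
    have h1 := mul_mem hUM hT
    have h2 := mul_mem (star_mem hUM) hT
    have h3 := hνadd _ h1 _ h2
    rw [hunit hUM hU, hunit (star_mem hUM) (Unitary.star_mem hU)] at h3
    nth_rw 1 [hPU]
    rw [smul_mul_assoc, add_mul, hνsmul _ _ (add_mem h1 h2), Complex.norm_real,
      Real.norm_of_nonneg (by positivity)]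
    calc ‖opAbs A‖ / 2 * ν (U * T + star U * T)
        ≤ ‖opAbs A‖ / 2 * (ν T + ν T) := by gcongr
      _ = ‖opAbs A‖ * ν T := by ring
  · intro h T hT
    have hle {B S : H →L[ℂ] H} (hB : B ∈ M) (hS : S ∈ M) (hn : ‖B‖ ≤ 1) : ν (B * S) ≤ ν S :=
      (h B hB S hS).trans (mul_le_of_le_one_left (hν0 S hS) hn)
    have happrox {B C S : H →L[ℂ] H} {ε : ℝ} (hε : 0 < ε) (hB : B ∈ M) (hC : C ∈ M) (hS : S ∈ M)
        (hBn : ‖B‖ ≤ 1) (hCn : ‖C‖ ≤ 1) : ν (B * S + (ε : ℂ) • C) ≤ ν S + ε * ν 1 := by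
      refine (hνadd _ (mul_mem hB hS) _ (hsmul hC)).trans ?_
      rw [hνsmul _ _ hC, Complex.norm_real, Real.norm_of_nonneg hε.le]
      have := hle hC (one_mem M) hCn
      rw [mul_one] at this
      gcongr
      exact hle hB hS hBn
    have hP := VonNeumannAlgebra.opAbs_mem hT
    have key {x y : ℝ} (hxy : ∀ ε : ℝ, 0 < ε → x ≤ y + ε * ν 1) : x ≤ y := by
      refine le_of_forall_pos_le_add fun δ hδ ↦ ?_
      have h1 := hν0 1 (one_mem M)
      refine (hxy (δ / (ν 1 + 1)) (by positivity)).trans ?_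
      gcongr
      rw [div_mul_eq_mul_div, div_le_iff₀ (by positivity)]
      nlinarith
    refine le_antisymm (key fun ε hε ↦ ?_) (key fun ε hε ↦ ?_)
    · obtain ⟨B, hB, C, hC, hBn, hCn, hTB, -⟩ := exists_approx_polar hT hε
      nth_rw 1 [hTB]
      exact happrox hε hB hB hP hBn hBn
    · obtain ⟨B, hB, C, hC, hBn, hCn, -, hPB⟩ := exists_approx_polar hT hε
      nth_rw 1 [hPB]
      exact happrox hε (star_mem hB) hC hT (by rwa [norm_star]) hCn
end

section
/- A diffuse finite von Neumann algebra (M, τ) satisfies the weak Dixmier property: for every positive T ∈ M, τ(T)·1 lies in the operator-norm closure of the convex hull of the set of S ∈ M with τ(Sⁿ) = τ(Tⁿ) for all n ≥ 0. -/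
open scoped ComplexOrder

open Filter Topology

section WeakDixmier

variable {H : Type} [NormedAddCommGroup H] [InnerProductSpace ℂ H] [CompleteSpace H]
  {M : VonNeumannAlgebra H} {τ : (H →L[ℂ] H) → ℂ}

namespace VonNeumannAlgebra

lemma mem_of_forall_commute {A : H →L[ℂ] H} (h : ∀ B ∈ M.commutant, Commute B A) : A ∈ M := by
  rw [← M.commutant_commutant, mem_commutant_iff]
  exact fun B hB => h B hB

lemma commute_of_mem_commutant {A B : H →L[ℂ] H} (hA : A ∈ M) (hB : B ∈ M.commutant) :
    Commute B A :=
  (mem_commutant_iff.1 hB A hA).symm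

lemma isClosed_coe (M : VonNeumannAlgebra H) : IsClosed (M : Set (H →L[ℂ] H)) := by
  rw [← M.centralizer_centralizer]
  exact Set.isClosed_centralizer _

lemma complex_smul_mem (M : VonNeumannAlgebra H) (c : ℂ) {A : H →L[ℂ] H} (hA : A ∈ M) :
    c • A ∈ M :=
  M.toStarSubalgebra.smul_mem hA c

lemma real_smul_mem (M : VonNeumannAlgebra H) (c : ℝ) {A : H →L[ℂ] H} (hA : A ∈ M) :
    c • A ∈ M := by
  have := M.complex_smul_mem (c : ℂ) hA
  simpa using this

lemma cfcHom_mem {A : H →L[ℂ] H} (hA : A ∈ M) (hsa : IsSelfAdjoint A) (f : C(spectrum ℝ A, ℝ)) :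
    cfcHom (R := ℝ) hsa f ∈ M :=
  mem_of_forall_commute fun B hB =>
    (Commute.cfcHom (𝕜 := ℝ) hsa (commute_of_mem_commutant hA hB).symm
      (by rw [hsa.star_eq]; exact (commute_of_mem_commutant hA hB).symm) f).symm

lemma exists_star_mul_self {A : H →L[ℂ] H} (hA : A ∈ M) (h0 : 0 ≤ A) :
    ∃ B ∈ M, A = star B * B := by
  refine ⟨CFC.sqrt A, mem_of_forall_commute fun B hB => ?_, ?_⟩
  · rw [CFC.sqrt_eq_cfc]
    exact ((commute_of_mem_commutant hA hB).symm.cfc_nnreal _).symm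
  · rw [(CFC.sqrt_nonneg A).isSelfAdjoint.star_eq, CFC.sqrt_mul_sqrt_self A h0]

/-- The projections of a von Neumann algebra. -/
def projections (M : VonNeumannAlgebra H) : Set (H →L[ℂ] H) :=
  {P | P ∈ M ∧ IsStarProjection P}

lemma zero_mem_projections (M : VonNeumannAlgebra H) : 0 ∈ M.projections :=
  ⟨zero_mem M, IsStarProjection.zero _⟩

lemma one_sub_mem_projections {P : H →L[ℂ] H} (hP : P ∈ M.projections) : 1 - P ∈ M.projections :=
  ⟨sub_mem (one_mem M) hP.1, hP.2.one_sub⟩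

lemma sub_mem_projections {P Q : H →L[ℂ] H} (hP : P ∈ M.projections) (hQ : Q ∈ M.projections)
    (h : P ≤ Q) : Q - P ∈ M.projections :=
  ⟨sub_mem hQ.1 hP.1, (hP.2.le_iff_sub hQ.2).1 h⟩

end VonNeumannAlgebra

namespace IsFaithfulTracialState

lemma map_zero (hτ : IsFaithfulTracialState M τ) : τ 0 = 0 := by simpa using hτ.map_smul 0 0

lemma map_neg (hτ : IsFaithfulTracialState M τ) (A) : τ (-A) = -τ A := by simpa using hτ.map_smul (-1) A

lemma map_sub (hτ : IsFaithfulTracialState M τ) (A B) : τ (A - B) = τ A - τ B := by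
  rw [sub_eq_add_neg, hτ.map_add, hτ.map_neg, sub_eq_add_neg]

lemma map_real_smul (hτ : IsFaithfulTracialState M τ) (c : ℝ) (A) : τ (c • A) = c * τ A := by
  simpa using hτ.map_smul c A

lemma map_sum (hτ : IsFaithfulTracialState M τ) {ι : Type*} (s : Finset ι) (f : ι → (H →L[ℂ] H)) :
    τ (∑ i ∈ s, f i) = ∑ i ∈ s, τ (f i) := by
  classical
  induction s using Finset.induction_on with
  | empty => simpa using hτ.map_zero
  | insert a s ha ih => rw [Finset.sum_insert ha, Finset.sum_insert ha, hτ.map_add, ih]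

lemma nonneg (hτ : IsFaithfulTracialState M τ) {A} (hA : A ∈ M) (h0 : 0 ≤ A) : 0 ≤ τ A := by
  obtain ⟨B, hB, rfl⟩ := M.exists_star_mul_self hA h0
  exact hτ.pos B hB

lemma mono (hτ : IsFaithfulTracialState M τ) {A B} (hA : A ∈ M) (hB : B ∈ M) (h : A ≤ B) : τ A ≤ τ B := by
  have := hτ.nonneg (sub_mem hB hA) (sub_nonneg.2 h)
  rwa [hτ.map_sub, sub_nonneg] at this

lemma eq_zero (hτ : IsFaithfulTracialState M τ) {A} (hA : A ∈ M) (h0 : 0 ≤ A) (h : τ A = 0) : A = 0 := by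
  obtain ⟨B, hB, rfl⟩ := M.exists_star_mul_self hA h0
  rw [hτ.faithful B hB h, mul_zero]

lemma ofReal_re (hτ : IsFaithfulTracialState M τ) {A} (hA : A ∈ M) (h0 : 0 ≤ A) : ((τ A).re : ℂ) = τ A :=
  Complex.ext (by simp) (by simpa using (Complex.le_def.1 (hτ.nonneg hA h0)).2)

lemma eq_of_le (hτ : IsFaithfulTracialState M τ) {A B} (hA : A ∈ M) (hB : B ∈ M) (h : A ≤ B) (h' : (τ B).re ≤ (τ A).re) : A = B := by
  have h0 := sub_nonneg.2 h
  have hm := sub_mem hB hA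
  refine (sub_eq_zero.1 (hτ.eq_zero hm h0 ?_)).symm
  have h1 := hτ.nonneg hm h0
  rw [← hτ.ofReal_re hm h0] at h1 ⊢
  have h2 : 0 ≤ (τ (B - A)).re := by simpa using h1
  have h3 : (τ (B - A)).re = (τ B).re - (τ A).re := by rw [hτ.map_sub, Complex.sub_re]
  have : (τ (B - A)).re = 0 := by linarith
  simp [this]

lemma norm_map_le (hτ : IsFaithfulTracialState M τ) {A} (hA : A ∈ M) (hsa : IsSelfAdjoint A) : ‖τ A‖ ≤ ‖A‖ := by
  have h1 : A ≤ algebraMap ℝ (H →L[ℂ] H) ‖A‖ := hsa.le_algebraMap_norm_self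
  have h2 : -(algebraMap ℝ (H →L[ℂ] H) ‖A‖) ≤ A := hsa.neg_algebraMap_norm_le_self
  rw [Algebra.algebraMap_eq_smul_one] at h1 h2
  have h3 := hτ.mono hA (M.real_smul_mem _ (one_mem M)) h1
  have h4 := hτ.mono (neg_mem (M.real_smul_mem _ (one_mem M))) hA h2
  rw [hτ.map_neg, hτ.map_real_smul, hτ.map_one, mul_one] at h4
  rw [hτ.map_real_smul, hτ.map_one, mul_one] at h3
  have h5 : τ A = ((τ A).re : ℂ) := Complex.ext (by simp) (by simpa using (Complex.le_def.1 h3).2)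
  rw [h5] at h3 h4 ⊢
  rw [Complex.norm_real, Real.norm_eq_abs, abs_le]
  exact ⟨by exact_mod_cast h4, by exact_mod_cast h3⟩

end IsFaithfulTracialState

/-- Normality of `τ` on the projections of `M`, as complete additivity. -/
def IsCompletelyAdditive (M : VonNeumannAlgebra H) (τ : (H →L[ℂ] H) → ℂ) : Prop :=
  ∀ {ι : Type} (P : ι → (H →L[ℂ] H)) (Q : H →L[ℂ] H),
    (∀ i, P i ∈ M ∧ IsSelfAdjoint (P i) ∧ P i * P i = P i) →
    Q ∈ M → IsSelfAdjoint Q → Q * Q = Q →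
    (∀ i j, i ≠ j → P i * P j = 0) →
    (∀ x : H, HasSum (fun i => P i x) (Q x)) →
    HasSum (fun i => τ (P i)) (τ Q)

/-- Pairwise orthogonal star projections whose partial sums are star projections converging
strongly to `Q` are unconditionally summable to `Q`. -/
lemma hasSum_apply_of_orthogonal {D : ℕ → H →L[ℂ] H} {Q : H →L[ℂ] H}
    (hD : ∀ n, IsStarProjection (D n)) (horth : ∀ i j, i ≠ j → D i * D j = 0)
    (hsum : ∀ n, IsStarProjection (∑ i ∈ Finset.range n, D i)) (x : H)
    (hlim : Tendsto (fun n => (∑ i ∈ Finset.range n, D i) x) atTop (𝓝 (Q x))) :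
    HasSum (fun n => D n x) (Q x) := by
  have hnorm : ∀ P : H →L[ℂ] H, IsStarProjection P → ‖P x‖ ^ 2 = RCLike.re (inner ℂ (P x) x) := by
    intro P hP
    have h1 : inner ℂ (P x) (P x) = inner ℂ (P x) x := by
      rw [← ContinuousLinearMap.adjoint_inner_left, ← ContinuousLinearMap.star_eq_adjoint,
        hP.isSelfAdjoint.star_eq, ← mul_apply_eq_comp, hP.isIdempotentElem.eq]
    rw [← h1, inner_self_eq_norm_sq]
  have hfam : OrthogonalFamily ℂ (fun n => LinearMap.range (D n).toLinearMap)
      (fun n => (LinearMap.range (D n).toLinearMap).subtypeₗᵢ) := by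
    rintro i j hij ⟨_, v, rfl⟩ ⟨_, w, rfl⟩
    change inner ℂ (D i v) (D j w) = 0
    rw [← ContinuousLinearMap.adjoint_inner_right, ← ContinuousLinearMap.star_eq_adjoint,
      (hD i).isSelfAdjoint.star_eq, ← mul_apply_eq_comp, horth i j hij]
    simp
  have hsm : Summable (fun n => D n x) := by
    refine (hfam.summable_iff_norm_sq_summable (fun n => ⟨D n x, x, rfl⟩)).2 ?_
    refine summable_of_sum_range_le (c := ‖x‖ * ‖x‖) (fun n => by positivity) fun n => ?_
    have h2 : ∀ i, ‖(⟨D i x, x, rfl⟩ : LinearMap.range (D i).toLinearMap)‖ ^ 2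
        = RCLike.re (inner ℂ (D i x) x) := fun i => hnorm _ (hD i)
    simp_rw [h2]
    rw [← map_sum, ← sum_inner, ← sum_apply]
    refine (re_inner_le_norm _ _).trans ?_
    gcongr
    calc _ ≤ ‖∑ i ∈ Finset.range n, D i‖ * ‖x‖ := ContinuousLinearMap.le_opNorm _ _
      _ ≤ 1 * ‖x‖ := by gcongr; exact (hsum n).norm_le
      _ = ‖x‖ := one_mul _
  refine hsm.hasSum_iff_tendsto_nat.2 ?_
  simpa using hlim

lemma VonNeumannAlgebra.exists_tendsto_of_monotone {P : ℕ → H →L[ℂ] H}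
    (hP : ∀ n, P n ∈ M.projections) (hmono : Monotone P) :
    ∃ Q ∈ M.projections, ∀ x, Tendsto (fun n => P n x) atTop (𝓝 (Q x)) := by
  let U : ℕ → Submodule ℂ H := fun n => LinearMap.range (P n).toLinearMap
  have hU : ∀ n, ∃ _ : (U n).HasOrthogonalProjection, P n = (U n).starProjection := fun n =>
    isStarProjection_iff_eq_starProjection_range.1 (hP n).2
  have : ∀ n, (U n).HasOrthogonalProjection := fun n => (hU n).1
  have hPU : ∀ n, P n = (U n).starProjection := fun n => (hU n).2
  have hUmono : Monotone U := by
    rintro i j hij _ ⟨v, rfl⟩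
    refine ⟨P i v, ?_⟩
    change (P j * P i) v = _
    rw [((hP i).2.le_iff_mul_eq_right (hP j).2).1 (hmono hij)]
    rfl
  refine ⟨(⨆ n, U n).topologicalClosure.starProjection, ⟨?_, isStarProjection_starProjection⟩, ?_⟩
  rotate_left
  · intro x
    simp_rw [hPU]
    exact Submodule.starProjection_tendsto_closure_iSup U hUmono x
  have key := Submodule.starProjection_tendsto_closure_iSup U hUmono
  simp_rw [← hPU] at key
  refine mem_of_forall_commute fun B hB => ContinuousLinearMap.ext fun x => ?_
  refine tendsto_nhds_unique ((B.continuous.tendsto _).comp (key x)) ?_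
  refine (key (B x)).congr fun n => ?_
  exact (congrArg (fun A : H →L[ℂ] H => A x) (commute_of_mem_commutant (hP n).1 hB).eq).symm

/-- An increasing sequence of projections of `M` has a least upper bound, and `τ` is continuous
along it. -/
lemma IsFaithfulTracialState.exists_lub_of_monotone (hτ : IsFaithfulTracialState M τ)
    (hn : IsCompletelyAdditive M τ)
    {P : ℕ → H →L[ℂ] H} (hP : ∀ n, P n ∈ M.projections) (hmono : Monotone P) :
    ∃ Q ∈ M.projections, (∀ n, P n ≤ Q) ∧ (∀ R ∈ M.projections, (∀ n, P n ≤ R) → Q ≤ R) ∧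
      Tendsto (fun n => τ (P n)) atTop (𝓝 (τ Q)) := by
  obtain ⟨Q, hQ, hlim⟩ := M.exists_tendsto_of_monotone hP hmono
  refine ⟨Q, hQ, fun n => ?_, fun R hR hPR => ?_, ?_⟩
  · rw [(hP n).2.le_iff_mul_eq_right hQ.2]
    ext x
    refine tendsto_nhds_unique (hlim (P n x)) ?_
    refine tendsto_const_nhds.congr' ?_
    filter_upwards [eventually_ge_atTop n] with m hm
    exact (congrArg (fun A : H →L[ℂ] H => A x)
      (((hP n).2.le_iff_mul_eq_right (hP m).2).1 (hmono hm))).symm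
  · rw [hQ.2.le_iff_mul_eq_right hR.2]
    ext x
    refine tendsto_nhds_unique ((R.continuous.tendsto _).comp (hlim x)) ?_
    refine (hlim x).congr fun n => ?_
    exact (congrArg (fun A : H →L[ℂ] H => A x)
      (((hP n).2.le_iff_mul_eq_right hR.2).1 (hPR n))).symm
  · let D : ℕ → H →L[ℂ] H := fun n => Nat.casesOn n (P 0) fun k => P (k + 1) - P k
    have hDP : ∀ n, ∑ i ∈ Finset.range (n + 1), D i = P n := by
      intro n
      induction n with
      | zero => simp [D]
      | succ k ih => rw [Finset.sum_range_succ, ih]; simp [D]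
    have hD : ∀ n, D n ∈ M.projections := by
      rintro (_ | k)
      · exact hP 0
      · exact VonNeumannAlgebra.sub_mem_projections (hP k) (hP _) (hmono k.le_succ)
    have hl : ∀ {i j}, i ≤ j → P i * P j = P i := fun h =>
      ((hP _).2.le_iff_mul_eq_left (hP _).2).1 (hmono h)
    have hr : ∀ {i j}, i ≤ j → P j * P i = P i := fun h =>
      ((hP _).2.le_iff_mul_eq_right (hP _).2).1 (hmono h)
    have horth' : ∀ i j, i < j → D i * D j = 0 ∧ D j * D i = 0 := by
      rintro (_ | i) (_ | j) h
      · omega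
      · simp [D, mul_sub, sub_mul, hl (Nat.zero_le _), hr (Nat.zero_le _)]
      · omega
      · have h1 : i ≤ j := by omega
        have h2 : i + 1 ≤ j := by omega
        have h3 : i ≤ j + 1 := by omega
        have h4 : i + 1 ≤ j + 1 := by omega
        simp [D, mul_sub, sub_mul, hl h1, hl h2, hl h3, hl h4, hr h1, hr h2, hr h3, hr h4]
    have horth : ∀ i j, i ≠ j → D i * D j = 0 := fun i j h =>
      (lt_or_gt_of_ne h).elim (fun h => (horth' i j h).1) (fun h => (horth' j i h).2)
    have hsum : ∀ n, IsStarProjection (∑ i ∈ Finset.range n, D i) := by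
      rintro (_ | n)
      · simp [IsStarProjection.zero]
      · rw [hDP]; exact (hP n).2
    have hx : ∀ x, HasSum (fun n => D n x) (Q x) := fun x =>
      hasSum_apply_of_orthogonal (fun n => (hD n).2) horth hsum x
        ((tendsto_add_atTop_iff_nat 1).1 (by simpa only [hDP] using hlim x))
    have := hn D Q (fun i => ⟨(hD i).1, (hD i).2.isSelfAdjoint, (hD i).2.isIdempotentElem.eq⟩)
      hQ.1 hQ.2.isSelfAdjoint hQ.2.isIdempotentElem.eq horth hx
    have := (tendsto_add_atTop_iff_nat 1).2 this.tendsto_sum_nat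
    simpa only [← hτ.map_sum, hDP] using this

namespace VonNeumannAlgebra

/-- A maximal chain of projections of `M`. -/
structure IsSaturatedChain (M : VonNeumannAlgebra H) (C : Set (H →L[ℂ] H)) : Prop where
  subset : C ⊆ M.projections
  total : ∀ P ∈ C, ∀ Q ∈ C, P ≤ Q ∨ Q ≤ P
  mem : ∀ P ∈ M.projections, (∀ Q ∈ C, P ≤ Q ∨ Q ≤ P) → P ∈ C

lemma exists_isSaturatedChain (M : VonNeumannAlgebra H) : ∃ C, M.IsSaturatedChain C := by
  let c : Set M.projections := maxChain (· ≤ ·)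
  have hc : IsMaxChain (· ≤ ·) c := maxChain_spec
  refine ⟨Subtype.val '' c, ⟨?_, ?_, ?_⟩⟩
  · rintro _ ⟨P, -, rfl⟩
    exact P.2
  · rintro _ ⟨P, hP, rfl⟩ _ ⟨Q, hQ, rfl⟩
    exact hc.1.total hP hQ
  · intro P hP h
    have h2 : IsChain (· ≤ ·) (insert (⟨P, hP⟩ : M.projections) c) :=
      hc.1.insert fun Q hQ _ => h Q ⟨Q, hQ, rfl⟩
    refine ⟨⟨P, hP⟩, ?_, rfl⟩
    rw [hc.2 h2 (Set.subset_insert _ _)]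
    exact Set.mem_insert _ _

lemma IsSaturatedChain.compl {C : Set (H →L[ℂ] H)} (hC : M.IsSaturatedChain C) :
    M.IsSaturatedChain {P | 1 - P ∈ C} where
  subset P hP := by simpa using one_sub_mem_projections (hC.subset hP)
  total P hP Q hQ :=
    (hC.total _ hQ _ hP).imp (sub_le_sub_iff_left 1).1 (sub_le_sub_iff_left 1).1
  mem P hP h := by
    refine hC.mem _ (one_sub_mem_projections hP) fun Q hQ => ?_
    have := h (1 - Q) (by simpa using hQ)
    rwa [le_sub_comm, or_comm, sub_le_comm] at this

lemma IsSaturatedChain.zero_mem {C : Set (H →L[ℂ] H)} (hC : M.IsSaturatedChain C) : 0 ∈ C :=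
  hC.mem 0 M.zero_mem_projections fun _ hQ => Or.inl (hC.subset hQ).2.nonneg

/-- `M` has no minimal projections. -/
def IsDiffuse (M : VonNeumannAlgebra H) : Prop :=
  ∀ P ∈ M, IsSelfAdjoint P → P * P = P → P ≠ 0 →
    ∃ Q ∈ M, IsSelfAdjoint Q ∧ Q * Q = Q ∧ Q ≠ 0 ∧ Q ≠ P ∧ Q ≤ P

end VonNeumannAlgebra

namespace IsFaithfulTracialState

lemma exists_greatest_of_isSaturatedChain (hτ : IsFaithfulTracialState M τ)
    (hn : IsCompletelyAdditive M τ)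
    {C : Set (H →L[ℂ] H)} (hC : M.IsSaturatedChain C) {t : ℝ} (ht : 0 ≤ t) :
    ∃ P ∈ C, (τ P).re ≤ t ∧ ∀ Q ∈ C, (τ Q).re ≤ t → Q ≤ P := by
  let S : Set ℝ := (fun P => (τ P).re) '' {P | P ∈ C ∧ (τ P).re ≤ t}
  have hS : S.Nonempty := ⟨_, 0, ⟨hC.zero_mem, by simpa [hτ.map_zero] using ht⟩, rfl⟩
  have hS' : BddAbove S := ⟨t, by rintro _ ⟨P, hP, rfl⟩; exact hP.2⟩
  obtain ⟨u, humono, hulim, hu⟩ := exists_seq_tendsto_sSup hS hS'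
  choose P hP hPu using hu
  have hPmono : Monotone P := by
    refine monotone_nat_of_le_succ fun n => ?_
    rcases hC.total _ (hP n).1 _ (hP (n + 1)).1 with h | h
    · exact h
    · refine (hτ.eq_of_le (hC.subset (hP _).1).1 (hC.subset (hP _).1).1 h ?_).ge
      have := humono n.le_succ
      rwa [← hPu n, ← hPu (n + 1)] at this
  obtain ⟨R, hR, hPR, hRle, hlim⟩ :=
    hτ.exists_lub_of_monotone hn (fun n => hC.subset (hP n).1) hPmono
  have hRC : R ∈ C := by
    refine hC.mem R hR fun Q hQ => ?_
    by_cases h : ∀ n, P n ≤ Q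
    · exact Or.inl (hRle Q (hC.subset hQ) h)
    · push Not at h
      obtain ⟨n, hn⟩ := h
      exact Or.inr (((hC.total _ (hP n).1 _ hQ).resolve_left hn).trans (hPR n))
  have hRs : (τ R).re = sSup S := by
    refine tendsto_nhds_unique ((Complex.continuous_re.tendsto _).comp hlim) ?_
    exact hulim.congr fun n => (hPu n).symm
  refine ⟨R, hRC, hRs.le.trans (csSup_le hS ?_), fun Q hQ hQt => ?_⟩
  · rintro _ ⟨P, hP, rfl⟩
    exact hP.2
  · refine (hC.total _ hQ _ hRC).elim id fun h => (hτ.eq_of_le hR.1 (hC.subset hQ).1 h ?_).ge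
    rw [hRs]
    exact le_csSup hS' ⟨Q, ⟨hQ, hQt⟩, rfl⟩

lemma exists_trace_eq_of_isSaturatedChain (hτ : IsFaithfulTracialState M τ)
    (hn : IsCompletelyAdditive M τ) (hd : M.IsDiffuse)
    {C : Set (H →L[ℂ] H)} (hC : M.IsSaturatedChain C) {t : ℝ} (ht : 0 ≤ t) (ht1 : t ≤ 1) :
    ∃ P ∈ C, τ P = t := by
  have hre : ∀ P, (τ (1 - P)).re = 1 - (τ P).re := fun P => by
    rw [hτ.map_sub, hτ.map_one]; simp
  obtain ⟨P, hP, hPt, hPmax⟩ := hτ.exists_greatest_of_isSaturatedChain hn hC ht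
  obtain ⟨R', hR', hR't, hR'max⟩ :=
    hτ.exists_greatest_of_isSaturatedChain hn hC.compl (sub_nonneg.2 ht1)
  obtain ⟨R, rfl⟩ : ∃ R, R' = 1 - R := ⟨1 - R', by simp⟩
  replace hR' : R ∈ C := by simpa using hR'
  have hRt : t ≤ (τ R).re := by rw [hre] at hR't; linarith
  have hRmin : ∀ Q ∈ C, t ≤ (τ Q).re → R ≤ Q := fun Q hQ h => by
    exact (sub_le_sub_iff_left 1).1 (hR'max (1 - Q) (by simpa using hQ) (by rw [hre]; linarith))
  have hPp := hC.subset hP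
  have hRp := hC.subset hR'
  suffices h : t ≤ (τ P).re by
    refine ⟨P, hP, ?_⟩
    rw [← hτ.ofReal_re hPp.1 hPp.2.nonneg, le_antisymm hPt h]
  rcases hC.total _ hP _ hR' with h | h
  · by_contra hlt
    have hne : R - P ≠ 0 := fun h0 => hlt (by rwa [← sub_eq_zero.1 h0])
    have hRP := VonNeumannAlgebra.sub_mem_projections hPp hRp h
    obtain ⟨Q, hQM, hQsa, hQQ, hQ0, hQne, hQle⟩ :=
      hd _ hRP.1 hRP.2.isSelfAdjoint hRP.2.isIdempotentElem.eq hne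
    have hQp : IsStarProjection Q := ⟨hQQ, hQsa⟩
    have hPQ : P * Q = 0 := by
      have h1 : (R - P) * Q = Q := (hQp.le_iff_mul_eq_right hRP.2).1 hQle
      have h2 : P * R = P := (hPp.2.le_iff_mul_eq_left hRp.2).1 h
      rw [← h1, ← mul_assoc, mul_sub, h2, hPp.2.isIdempotentElem.eq, sub_self, zero_mul]
    have hle : P + Q ≤ R := le_sub_iff_add_le'.1 hQle
    have hPle : P ≤ P + Q := le_add_of_nonneg_right hQp.nonneg
    have hmem : P + Q ∈ C := by
      refine hC.mem _ ⟨add_mem hPp.1 hQM, hPp.2.add hQp hPQ⟩ fun Z hZ => ?_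
      rcases le_total (τ Z).re t with h | h
      · exact Or.inr ((hPmax Z hZ h).trans hPle)
      · exact Or.inl (hle.trans (hRmin Z hZ h))
    rcases le_total (τ (P + Q)).re t with h | h
    · exact hQ0 (le_antisymm (by simpa using hPmax _ hmem h) hQp.nonneg)
    · exact hQne (le_antisymm hQle (sub_le_iff_le_add'.2 (hRmin _ hmem h)))
  · exact hRt.trans (Complex.le_def.1 (hτ.mono hRp.1 hPp.1 h)).1

end IsFaithfulTracialState

/-- A monotone `M`-valued function on `ℝ` with trace `x` at `x` and all of whose increments over
intervals of length at most one are projections. Its increments give an embedding of the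
algebra generated by the arcs of the circle `ℝ / ℤ` into `M`. -/
structure IsCircleChain (M : VonNeumannAlgebra H) (τ : (H →L[ℂ] H) → ℂ)
    (W : ℝ → H →L[ℂ] H) : Prop where
  mem : ∀ x, W x ∈ M
  mono : Monotone W
  add_one : ∀ x, W (x + 1) = W x + 1
  trace : ∀ x, τ (W x) = x
  proj : ∀ x y, x ≤ y → y ≤ x + 1 → IsStarProjection (W y - W x)

lemma IsFaithfulTracialState.exists_isCircleChain (hτ : IsFaithfulTracialState M τ)
    (hn : IsCompletelyAdditive M τ) (hd : M.IsDiffuse) : ∃ W, IsCircleChain M τ W := by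
  obtain ⟨C, hC⟩ := M.exists_isSaturatedChain
  have hE : ∀ t : ℝ, ∃ P, (P ∈ C ∧ τ P = Int.fract t) := fun t =>
    hτ.exists_trace_eq_of_isSaturatedChain hn hd hC (Int.fract_nonneg t) (Int.fract_lt_one t).le
  choose E hEC hEt using hE
  have hEp := fun t => hC.subset (hEC t)
  have hmono : ∀ s t, Int.fract s ≤ Int.fract t → E s ≤ E t := fun s t hst => by
    refine (hC.total _ (hEC s) _ (hEC t)).elim id fun h => ?_
    refine (hτ.eq_of_le (hEp t).1 (hEp s).1 h ?_).ge
    simpa [hEt] using hst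
  have hfloor : ∀ x y : ℝ, ⌊x⌋ < ⌊y⌋ →
      ((⌊x⌋ : ℝ) • (1 : H →L[ℂ] H)) + 1 ≤ ((⌊y⌋ : ℝ) • (1 : H →L[ℂ] H)) := fun x y h => by
    have h0 : (0 : ℝ) ≤ ⌊y⌋ - (⌊x⌋ + 1) := by
      rw [sub_nonneg]; exact_mod_cast h
    have := smul_nonneg h0 (zero_le_one (α := H →L[ℂ] H))
    rwa [sub_smul, add_smul, one_smul, sub_nonneg] at this
  refine ⟨fun x => (⌊x⌋ : ℝ) • (1 : H →L[ℂ] H) + E x, ⟨fun x => ?_, ?_, ?_, ?_, ?_⟩⟩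
  · exact add_mem (M.real_smul_mem _ (one_mem M)) (hEp x).1
  · intro x y hxy
    dsimp only
    rcases (Int.floor_mono hxy).eq_or_lt with h | h
    · rw [h]
      have := hmono x y (by rw [Int.fract, Int.fract, h]; linarith)
      gcongr
    · calc _ ≤ (⌊x⌋ : ℝ) • (1 : H →L[ℂ] H) + 1 := by gcongr; exact (hEp x).2.le_one
        _ ≤ (⌊y⌋ : ℝ) • (1 : H →L[ℂ] H) := hfloor x y h
        _ ≤ _ := le_add_of_nonneg_right (hEp y).2.nonneg
  · intro x
    have : E (x + 1) = E x := le_antisymm (hmono _ _ (by simp)) (hmono _ _ (by simp))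
    simp only [this, Int.floor_add_one, Int.cast_add, Int.cast_one, add_smul, one_smul]
    abel
  · intro x
    rw [hτ.map_add, hτ.map_real_smul, hτ.map_one, hEt, mul_one]
    exact_mod_cast Int.floor_add_fract x
  · intro x y hxy hyx
    have h1 := Int.floor_mono hxy
    have h2 := Int.floor_mono hyx
    rw [Int.floor_add_one] at h2
    rcases h1.eq_or_lt with h | h
    · rw [h, add_sub_add_left_eq_sub]
      exact (VonNeumannAlgebra.sub_mem_projections (hEp x) (hEp y)
        (hmono x y (by rw [Int.fract, Int.fract, h]; linarith))).2
    · have h3 : ⌊y⌋ = ⌊x⌋ + 1 := by omega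
      have h4 : E y ≤ E x := hmono _ _ (by rw [Int.fract, Int.fract, h3]; push_cast; linarith)
      have : (⌊y⌋ : ℝ) • (1 : H →L[ℂ] H) + E y - ((⌊x⌋ : ℝ) • (1 : H →L[ℂ] H) + E x)
          = 1 - (E x - E y) := by
        rw [h3]; push_cast; rw [add_smul, one_smul]; abel
      rw [this]
      exact (VonNeumannAlgebra.one_sub_mem_projections
        (VonNeumannAlgebra.sub_mem_projections (hEp y) (hEp x) h4)).2

open MeasureTheory in
/-- The distribution of a positive element of `M` with respect to `τ`. -/
lemma IsFaithfulTracialState.exists_distribution (hτ : IsFaithfulTracialState M τ)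
    {A : H →L[ℂ] H} (hA : A ∈ M) (h0 : 0 ≤ A) :
    ∃ μ : Measure ℝ, IsProbabilityMeasure μ ∧ (∀ᵐ x ∂μ, x ∈ Set.Icc 0 ‖A‖) ∧
      ∀ n : ℕ, τ (A ^ n) = ((∫ x, x ^ n ∂μ : ℝ) : ℂ) := by
  have hsa : IsSelfAdjoint A := h0.isSelfAdjoint
  have hpos : ∀ f : C(spectrum ℝ A, ℝ), 0 ≤ f → 0 ≤ (τ (cfcHom (R := ℝ) hsa f)).re := fun f hf =>
    (Complex.le_def.1 (hτ.nonneg (M.cfcHom_mem hA hsa f)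
      ((cfcHom_nonneg_iff (R := ℝ) hsa).2 hf))).1
  let Λ : CompactlySupportedContinuousMap (spectrum ℝ A) ℝ →ₚ[ℝ] ℝ := PositiveLinearMap.mk₀
    { toFun := fun f => (τ (cfcHom (R := ℝ) hsa f.toContinuousMap)).re
      map_add' := fun f g => by
        rw [← Complex.add_re, ← hτ.map_add, ← _root_.map_add]; rfl
      map_smul' := fun c f => by
        have : cfcHom (R := ℝ) hsa (c • f).toContinuousMap
            = c • cfcHom (R := ℝ) hsa f.toContinuousMap := by rw [← _root_.map_smul]; rfl
        rw [this, hτ.map_real_smul]; simp }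
    (fun f hf => hpos _ hf)
  let ν := RealRMK.rieszMeasure Λ
  have hν : ∀ n : ℕ, ((∫ x, (x : ℝ) ^ n ∂ν : ℝ) : ℂ) = τ (A ^ n) := by
    intro n
    let g : C(spectrum ℝ A, ℝ) := (ContinuousMap.id ℝ).restrict _
    let f : CompactlySupportedContinuousMap (spectrum ℝ A) ℝ :=
      ⟨g ^ n, HasCompactSupport.of_compactSpace _⟩
    have h1 : ∫ x, f x ∂ν = Λ f := RealRMK.integral_rieszMeasure Λ f
    have h2 : cfcHom (R := ℝ) hsa f.toContinuousMap = A ^ n := by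
      change cfcHom (R := ℝ) hsa (g ^ n) = _
      rw [map_pow, cfcHom_id]
    have h3 : Λ f = (τ (A ^ n)).re := by
      rw [← h2]; rfl
    rw [h3] at h1
    rw [← hτ.ofReal_re (pow_mem hA n) (CStarAlgebra.pow_nonneg h0 n), ← h1]
    rfl
  refine ⟨ν.map Subtype.val, ?_, ?_, fun n => ?_⟩
  · have := hν 0
    simp only [pow_zero, integral_const, smul_eq_mul, mul_one, hτ.map_one] at this
    have h1 : ν.real Set.univ = 1 := by exact_mod_cast this
    have : IsProbabilityMeasure ν := ⟨by
      rwa [Measure.real, ENNReal.toReal_eq_one_iff] at h1⟩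
    exact Measure.isProbabilityMeasure_map measurable_subtype_coe.aemeasurable
  · refine (ae_map_iff measurable_subtype_coe.aemeasurable measurableSet_Icc).2 ?_
    refine ae_of_all _ fun x => ⟨spectrum_nonneg_of_nonneg h0 x.2, ?_⟩
    calc (x : ℝ) ≤ ‖(x : ℝ)‖ := le_abs_self _
      _ ≤ ‖A‖ * ‖(1 : H →L[ℂ] H)‖ := spectrum.norm_le_norm_mul_of_mem x.2
      _ ≤ ‖A‖ := mul_le_of_le_one_right (norm_nonneg _) ContinuousLinearMap.norm_id_le
  · rw [← hν n, integral_map measurable_subtype_coe.aemeasurable (by fun_prop)]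

lemma norm_le_one_of_nonneg_of_le_one {A : H →L[ℂ] H} (h0 : 0 ≤ A) (h1 : A ≤ 1) : ‖A‖ ≤ 1 :=
  (CStarAlgebra.norm_le_norm_of_nonneg_of_le h0 h1).trans ContinuousLinearMap.norm_id_le

lemma sum_smul_pow_of_orthogonal {R : Type*} [Ring R] [Algebra ℝ R] {D : ℕ → R}
    (hD : ∀ i, D i * D i = D i)
    (horth : ∀ i j, i ≠ j → D i * D j = 0) (c : ℕ → ℝ) (N n : ℕ) :
    (∑ i ∈ Finset.range N, c i • D i) ^ (n + 1) = ∑ i ∈ Finset.range N, c i ^ (n + 1) • D i := by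
  induction n with
  | zero => simp
  | succ n ih =>
    rw [pow_succ, ih, Finset.sum_mul_sum]
    refine Finset.sum_congr rfl fun i hi => ?_
    rw [Finset.sum_eq_single_of_mem i hi fun j _ hj => by
      rw [smul_mul_smul_comm, horth i j hj.symm, smul_zero], smul_mul_smul_comm, hD, ← pow_succ]

/-- A resolution of the identity by projections of `M`, supported in `(-∞, L]`. -/
structure IsResolution (M : VonNeumannAlgebra H) (L : ℝ) (G : ℝ → H →L[ℂ] H) : Prop where
  mem : ∀ x, G x ∈ M.projections
  mono : Monotone G
  eq_one : G L = 1

/-- The Riemann sum of `∫₀ᴸ x dG(x) = L - ∫₀ᴸ G(x) dx` for the subdivision of `[0, L]` into `N`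
equal parts. -/
noncomputable def riemannSum (G : ℝ → H →L[ℂ] H) (L : ℝ) (N : ℕ) : H →L[ℂ] H :=
  L • (1 : H →L[ℂ] H) - (L / N) • ∑ i ∈ Finset.range N, G (L * i / N)

namespace IsResolution

variable {L : ℝ} {G : ℝ → H →L[ℂ] H}

lemma riemannSum_mem (hG : IsResolution M L G) (N : ℕ) : riemannSum G L N ∈ M :=
  sub_mem (M.real_smul_mem _ (one_mem M))
    (M.real_smul_mem _ (sum_mem fun _ _ => (hG.mem _).1))

lemma isSelfAdjoint_riemannSum (hG : IsResolution M L G) (N : ℕ) :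
    IsSelfAdjoint (riemannSum G L N) := by
  refine ((IsSelfAdjoint.all L).smul (.one _)).sub ((IsSelfAdjoint.all _).smul ?_)
  exact (Finset.sum_nonneg fun _ _ => (hG.mem _).2.nonneg).isSelfAdjoint

lemma norm_riemannSum_sub_le (hG : IsResolution M L G) (hL : 0 ≤ L) (N : ℕ) :
    ‖riemannSum G L N - riemannSum G L (2 * N)‖ ≤ L / (2 * N) := by
  rcases N.eq_zero_or_pos with rfl | hN
  · simp
  have hN' : (0 : ℝ) < N := by exact_mod_cast hN
  let f : ℕ → H →L[ℂ] H := fun i => G (L * i / (2 * N : ℕ))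
  have hf : Monotone f := fun i j hij => hG.mono (by gcongr)
  have hsplit : ∀ n, ∑ i ∈ Finset.range (2 * n), f i
      = 2 • ∑ i ∈ Finset.range n, f (2 * i)
        + ∑ i ∈ Finset.range n, (f (2 * i + 1) - f (2 * i)) := by
    intro n
    induction n with
    | zero => simp
    | succ n ih =>
      rw [mul_add, mul_one, Finset.sum_range_succ, Finset.sum_range_succ, ih,
        Finset.sum_range_succ, Finset.sum_range_succ]
      module
  have hle : ∑ i ∈ Finset.range N, (f (2 * i + 1) - f (2 * i)) ≤ 1 := by
    calc _ ≤ ∑ i ∈ Finset.range N, (f (2 * (i + 1)) - f (2 * i)) := by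
          gcongr with i; exact hf (by omega)
      _ = f (2 * N) - f (2 * 0) := Finset.sum_range_sub (fun i => f (2 * i)) N
      _ ≤ f (2 * N) := sub_le_self _ (hG.mem _).2.nonneg
      _ ≤ 1 := (hG.mem _).2.le_one
  have h0 : 0 ≤ ∑ i ∈ Finset.range N, (f (2 * i + 1) - f (2 * i)) :=
    Finset.sum_nonneg fun i _ => sub_nonneg.2 (hf (Nat.le_succ _))
  have heven : ∀ i : ℕ, G (L * i / N) = f (2 * i) := fun i => by
    simp only [f]; congr 1; push_cast; field_simp
  have : riemannSum G L N - riemannSum G L (2 * N)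
      = (L / (2 * N)) • ∑ i ∈ Finset.range N, (f (2 * i + 1) - f (2 * i)) := by
    simp only [riemannSum, heven]
    change _ - (_ - _ • ∑ i ∈ Finset.range (2 * N), f i) = _
    rw [hsplit]
    push_cast
    have h2 : L / N = L / (2 * N) * 2 := by field_simp
    rw [h2]
    module
  rw [this, norm_smul, Real.norm_of_nonneg (by positivity)]
  exact mul_le_of_le_one_right (by positivity) (norm_le_one_of_nonneg_of_le_one h0 hle)

lemma riemannSum_eq_sum (hG : IsResolution M L G) {N : ℕ} (hN : 0 < N) :
    riemannSum G L N = ∑ i ∈ Finset.range N,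
      (L * (i + 1 : ℕ) / N) • (G (L * (i + 1 : ℕ) / N) - G (L * i / N)) := by
  have key : ∀ n : ℕ, ∑ i ∈ Finset.range n,
      (L * (i + 1 : ℕ) / N) • (G (L * (i + 1 : ℕ) / N) - G (L * i / N))
      = (L * n / N) • G (L * n / N) - (L / N) • ∑ i ∈ Finset.range n, G (L * i / N) := by
    intro n
    induction n with
    | zero => simp
    | succ n ih =>
      rw [Finset.sum_range_succ, ih, Finset.sum_range_succ]
      have : L * n / N = L * (n + 1 : ℕ) / N - L / N := by push_cast; ring
      rw [this]
      module
  have hN' : (N : ℝ) ≠ 0 := by positivity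
  rw [key, riemannSum, mul_div_cancel_right₀ _ hN', hG.eq_one]

lemma riemannSum_pow (hG : IsResolution M L G) (hL : 0 ≤ L) {N : ℕ} (hN : 0 < N) (n : ℕ) :
    riemannSum G L N ^ (n + 1) = ∑ i ∈ Finset.range N,
      (L * (i + 1 : ℕ) / N) ^ (n + 1) • (G (L * (i + 1 : ℕ) / N) - G (L * i / N)) := by
  let g : ℕ → H →L[ℂ] H := fun i => G (L * i / N)
  have hg : Monotone g := fun i j hij => hG.mono (by gcongr)
  have hl : ∀ {i j}, i ≤ j → g i * g j = g i := fun h =>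
    ((hG.mem _).2.le_iff_mul_eq_left (hG.mem _).2).1 (hg h)
  have hr : ∀ {i j}, i ≤ j → g j * g i = g i := fun h =>
    ((hG.mem _).2.le_iff_mul_eq_right (hG.mem _).2).1 (hg h)
  rw [hG.riemannSum_eq_sum hN]
  refine sum_smul_pow_of_orthogonal (D := fun i => g (i + 1) - g i) (fun i => ?_)
    (fun i j hij => ?_) (fun i => L * (i + 1 : ℕ) / N) N n
  · exact (VonNeumannAlgebra.sub_mem_projections (hG.mem _) (hG.mem _)
      (hg i.le_succ)).2.isIdempotentElem.eq
  · rcases lt_or_gt_of_ne hij with h | h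
    · have h1 : i ≤ j := by omega
      have h2 : i + 1 ≤ j := by omega
      have h3 : i ≤ j + 1 := by omega
      have h4 : i + 1 ≤ j + 1 := by omega
      simp [mul_sub, sub_mul, hl h1, hl h2, hl h3, hl h4]
    · have h1 : j ≤ i := by omega
      have h2 : j + 1 ≤ i := by omega
      have h3 : j ≤ i + 1 := by omega
      have h4 : j + 1 ≤ i + 1 := by omega
      simp [mul_sub, sub_mul, hr h1, hr h2, hr h3, hr h4]

open MeasureTheory in
/-- The moments of Riemann sums approximate the moments of the scalar measure `τ ∘ dG`. -/
lemma norm_trace_riemannSum_pow_sub_le (hG : IsResolution M L G) (hτ : IsFaithfulTracialState M τ)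
    (hL : 0 ≤ L) {μ : Measure ℝ} [IsProbabilityMeasure μ] (hμ : ∀ᵐ x ∂μ, x ∈ Set.Icc 0 L)
    (hGμ : ∀ x, τ (G x) = μ.real (Set.Iic x)) {N : ℕ} (hN : 0 < N) (n : ℕ) :
    ‖τ (riemannSum G L N ^ (n + 1)) - ((∫ x, x ^ (n + 1) ∂μ : ℝ) : ℂ)‖
      ≤ L / N * (n + 1 : ℕ) * L ^ n := by
  have hN' : (0 : ℝ) < N := by exact_mod_cast hN
  let a : ℕ → ℝ := fun i => L * i / N
  have ha : Monotone a := fun i j hij => by simp only [a]; gcongr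
  have ha0 : a 0 = 0 := by simp [a]
  have haN : a N = L := by simp [a, hN'.ne']
  have hInt : ∀ s t : ℝ, IntervalIntegrable (fun x => x ^ (n + 1)) μ s t := fun s t =>
    (continuous_pow _).intervalIntegrable s t
  have hmom : ∫ x, x ^ (n + 1) ∂μ
      = ∑ i ∈ Finset.range N, ∫ x in a i..a (i + 1), x ^ (n + 1) ∂μ := by
    rw [intervalIntegral.sum_integral_adjacent_intervals fun k _ => hInt _ _, ha0, haN,
      intervalIntegral.integral_of_le hL, ← integral_indicator measurableSet_Ioc]
    refine integral_congr_ae ?_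
    filter_upwards [hμ] with x hx
    by_cases h : x ∈ Set.Ioc 0 L
    · rw [Set.indicator_of_mem h]
    · rw [Set.indicator_of_notMem h]
      have : x = 0 := le_antisymm (not_lt.1 fun h' => h ⟨h', hx.2⟩) hx.1
      simp [this]
  have hmass : ∀ i, μ.real (Set.Iic (a (i + 1))) - μ.real (Set.Iic (a i))
      = μ.real (Set.Ioc (a i) (a (i + 1))) := fun i => by
    have : Set.Ioc (a i) (a (i + 1)) = Set.Iic (a (i + 1)) \ Set.Iic (a i) := by
      ext; simp
    rw [this, measureReal_sdiff (Set.Iic_subset_Iic.2 (ha i.le_succ))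
      measurableSet_Iic]
  have htr : τ (riemannSum G L N ^ (n + 1)) = ((∑ i ∈ Finset.range N,
      a (i + 1) ^ (n + 1) * μ.real (Set.Ioc (a i) (a (i + 1))) : ℝ) : ℂ) := by
    rw [hG.riemannSum_pow hL hN, hτ.map_sum]
    push_cast
    refine Finset.sum_congr rfl fun i _ => ?_
    rw [hτ.map_real_smul, hτ.map_sub, hGμ, hGμ, ← hmass]
    simp [a]
  rw [htr, hmom, ← Complex.ofReal_sub, Complex.norm_real, ← Finset.sum_sub_distrib]
  have hterm : ∀ i ∈ Finset.range N,
      ‖a (i + 1) ^ (n + 1) * μ.real (Set.Ioc (a i) (a (i + 1)))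
        - ∫ x in a i..a (i + 1), x ^ (n + 1) ∂μ‖
      ≤ L / N * (n + 1 : ℕ) * L ^ n * μ.real (Set.Ioc (a i) (a (i + 1))) := by
    intro i hi
    have hi' : i + 1 ≤ N := Finset.mem_range.1 hi
    have hiL : a (i + 1) ≤ L := haN ▸ ha hi'
    have hi0 : 0 ≤ a i := ha0 ▸ ha (Nat.zero_le i)
    have hstep : a (i + 1) - a i = L / N := by simp only [a]; push_cast; ring
    have h1 : a (i + 1) ^ (n + 1) * μ.real (Set.Ioc (a i) (a (i + 1)))
        = ∫ x in Set.Ioc (a i) (a (i + 1)), a (i + 1) ^ (n + 1) ∂μ := by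
      rw [setIntegral_const, smul_eq_mul, mul_comm]
    rw [h1, intervalIntegral.integral_of_le (ha i.le_succ),
      ← integral_sub (integrable_const _) (hInt _ _).1]
    refine norm_setIntegral_le_of_norm_le_const (measure_lt_top _ _) fun x hx => ?_
    have hx0 : 0 ≤ x := hi0.trans hx.1.le
    have hxL : x ≤ L := hx.2.trans hiL
    refine (abs_pow_sub_pow_le _ _ _).trans ?_
    rw [Nat.add_sub_cancel, abs_of_nonneg (sub_nonneg.2 hx.2), abs_of_nonneg hx0,
      abs_of_nonneg (hx0.trans hx.2)]
    gcongr
    · linarith [hx.1]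
    · exact max_le hiL hxL
  refine (norm_sum_le _ _).trans ((Finset.sum_le_sum hterm).trans ?_)
  rw [← Finset.mul_sum]
  refine mul_le_of_le_one_right (by positivity) ?_
  simp_rw [← hmass]
  rw [Finset.sum_range_sub (fun i => μ.real (Set.Iic (a i)))]
  linarith [measureReal_nonneg (μ := μ) (s := Set.Iic (a 0)),
    measureReal_le_one (μ := μ) (s := Set.Iic (a N))]

open MeasureTheory in
/-- The spectral integral `∫ x dG(x)`: a uniform limit of its Riemann sums, with moments those of
the scalar measure `τ ∘ dG`. -/
lemma exists_spectralIntegral (hG : IsResolution M L G) (hτ : IsFaithfulTracialState M τ)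
    (hL : 0 ≤ L) {μ : Measure ℝ} [IsProbabilityMeasure μ] (hμ : ∀ᵐ x ∂μ, x ∈ Set.Icc 0 L)
    (hGμ : ∀ x, τ (G x) = μ.real (Set.Iic x)) :
    ∃ S ∈ M, IsSelfAdjoint S ∧ (∀ n : ℕ, τ (S ^ n) = ((∫ x, x ^ n ∂μ : ℝ) : ℂ)) ∧
      ∀ k : ℕ, ‖riemannSum G L (2 ^ k) - S‖ ≤ L / 2 ^ k := by
  let f : ℕ → H →L[ℂ] H := fun k => riemannSum G L (2 ^ k)
  have hf : ∀ k, dist (f k) (f (k + 1)) ≤ L / 2 / 2 ^ k := fun k => by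
    have := hG.norm_riemannSum_sub_le hL (2 ^ k)
    rw [dist_eq_norm]
    simp only [f, pow_succ']
    refine this.trans_eq ?_
    push_cast
    rw [div_div]
  obtain ⟨S, hS⟩ := cauchySeq_tendsto_of_complete (cauchySeq_of_le_geometric_two hf)
  have hSsa : IsSelfAdjoint S :=
    (isClosed_eq continuous_star continuous_id).mem_of_tendsto hS
      (Eventually.of_forall fun k => hG.isSelfAdjoint_riemannSum _)
  have hSM : S ∈ M := M.isClosed_coe.mem_of_tendsto hS (Eventually.of_forall fun k =>
    hG.riemannSum_mem _)
  refine ⟨S, hSM, hSsa, ?_, fun k => ?_⟩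
  · rintro (_ | n)
    · simp [hτ.map_one]
    have h1 : Tendsto (fun k => τ (f k ^ (n + 1))) atTop (𝓝 (τ (S ^ (n + 1)))) := by
      rw [tendsto_iff_norm_sub_tendsto_zero]
      refine squeeze_zero (fun _ => norm_nonneg _) (fun k => ?_)
        (tendsto_iff_norm_sub_tendsto_zero.1 (hS.pow (n + 1)))
      rw [← hτ.map_sub]
      exact hτ.norm_map_le (sub_mem (pow_mem (hG.riemannSum_mem _) _) (pow_mem hSM _))
        (((hG.isSelfAdjoint_riemannSum _).pow _).sub (hSsa.pow _))
    refine tendsto_nhds_unique h1 ?_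
    rw [tendsto_iff_norm_sub_tendsto_zero]
    refine squeeze_zero (fun _ => norm_nonneg _) (fun k =>
      hG.norm_trace_riemannSum_pow_sub_le hτ hL hμ hGμ (by positivity) n) ?_
    have h2 : Tendsto (fun k : ℕ => L / ((2 ^ k : ℕ) : ℝ)) atTop (𝓝 0) := by
      push_cast
      exact tendsto_const_nhds.div_atTop (tendsto_pow_atTop_atTop_of_one_lt one_lt_two)
    simpa using (h2.mul_const ((n + 1 : ℕ) : ℝ)).mul_const (L ^ n)
  · rw [← dist_eq_norm]
    exact dist_le_of_le_geometric_two_of_tendsto hf hS k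

end IsResolution

namespace IsCircleChain

variable {W : ℝ → H →L[ℂ] H}

/-- The average over the rotations by multiples of `1 / m` of the arc of length `c` is nearly
scalar. -/
lemma norm_average_sub_le (hW : IsCircleChain M τ W) {m : ℕ} (hm : 0 < m) {c : ℝ} (hc : 0 ≤ c) :
    ‖(m : ℝ)⁻¹ • ∑ j ∈ Finset.range m, (W (c - j / m) - W (-(j / m)))
      - c • (1 : H →L[ℂ] H)‖ ≤ 2 / m := by
  have hm' : (0 : ℝ) < m := by exact_mod_cast hm
  let g : ℝ → H →L[ℂ] H := fun x => ∑ j ∈ Finset.range m, W (x - j / m)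
  have hg : Monotone g := fun x y hxy => Finset.sum_le_sum fun j _ => hW.mono (by linarith)
  have hg1 : ∀ x, g (x + 1 / m) = g x + 1 := fun x => by
    let f : ℕ → H →L[ℂ] H := fun j => W (x + 1 / m - j / m)
    have h1 : g x = ∑ j ∈ Finset.range m, f (j + 1) := Finset.sum_congr rfl fun j _ => by
      simp only [f]; congr 1; push_cast; ring
    have h2 : f 0 = f m + 1 := by
      simp only [f]; rw [← hW.add_one]; congr 1; field_simp; simp
    have h3 : ∑ j ∈ Finset.range m, f (j + 1) + f 0 = ∑ j ∈ Finset.range m, f j + f m := by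
      rw [← Finset.sum_range_succ, ← Finset.sum_range_succ']
    rw [h2, ← h1] at h3
    have h4 : g x + 1 + f m = g (x + 1 / m) + f m := by rw [← h3]; abel
    exact (add_right_cancel h4).symm
  have hgk : ∀ k : ℕ, g (k / m) = g 0 + (k : ℝ) • (1 : H →L[ℂ] H) := fun k => by
    induction k with
    | zero => simp
    | succ k ih =>
      have : ((k + 1 : ℕ) : ℝ) / m = k / m + 1 / m := by push_cast; ring
      rw [this, hg1, ih]; push_cast; module
  let k := ⌊m * c⌋₊
  have hk : (k : ℝ) ≤ m * c := Nat.floor_le (by positivity)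
  have hk' : m * c < k + 1 := Nat.lt_floor_add_one _
  let B : H →L[ℂ] H := g c - g 0 - (k : ℝ) • (1 : H →L[ℂ] H)
  have hB0 : 0 ≤ B := by
    have : g (k / m) ≤ g c := hg (by rw [div_le_iff₀ hm']; linarith)
    rw [hgk] at this
    simp only [B, sub_sub]
    exact sub_nonneg.2 this
  have hB1 : B ≤ 1 := by
    have : g c ≤ g ((k + 1 : ℕ) / m) := hg (by
      rw [le_div_iff₀ hm']; push_cast; linarith)
    rw [hgk] at this
    simp only [B, sub_sub, sub_le_iff_le_add']
    refine this.trans_eq ?_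
    push_cast; module
  have hsum : ∑ j ∈ Finset.range m, (W (c - j / m) - W (-(j / m)))
      = (k : ℝ) • (1 : H →L[ℂ] H) + B := by
    rw [Finset.sum_sub_distrib]
    simp only [B, g, zero_sub]
    abel
  have : (m : ℝ)⁻¹ • ((k : ℝ) • (1 : H →L[ℂ] H) + B) - c • (1 : H →L[ℂ] H)
      = (m : ℝ)⁻¹ • (B - (m * c - k) • (1 : H →L[ℂ] H)) := by
    have hc' : c = (m : ℝ)⁻¹ * (m * c) := by field_simp
    nth_rw 1 [hc']
    module
  rw [hsum, this, norm_smul, Real.norm_of_nonneg (by positivity), inv_mul_eq_div]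
  gcongr
  calc _ ≤ ‖B‖ + ‖(m * c - k) • (1 : H →L[ℂ] H)‖ := norm_sub_le _ _
    _ ≤ 1 + 1 := by
      gcongr
      · exact norm_le_one_of_nonneg_of_le_one hB0 hB1
      · rw [norm_smul, Real.norm_of_nonneg (by linarith)]
        exact mul_le_one₀ (by linarith) (norm_nonneg _) ContinuousLinearMap.norm_id_le
    _ = 2 := one_add_one_eq_two

open MeasureTheory in
/-- The resolution of the identity with distribution `μ` carried by the chain rotated by `a`. -/
lemma isResolution (hW : IsCircleChain M τ W) {L : ℝ} {μ : Measure ℝ} [IsProbabilityMeasure μ]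
    (hμ : ∀ᵐ x ∂μ, x ∈ Set.Icc 0 L) (a : ℝ) :
    IsResolution M L (fun x => W (μ.real (Set.Iic x) - a) - W (-a)) where
  mem x := ⟨sub_mem (hW.mem _) (hW.mem _), hW.proj _ _
    (by linarith [measureReal_nonneg (μ := μ) (s := Set.Iic x)])
    (by linarith [measureReal_le_one (μ := μ) (s := Set.Iic x)])⟩
  mono x y hxy := sub_le_sub_right
    (hW.mono (sub_le_sub_right (measureReal_mono (Set.Iic_subset_Iic.2 hxy)) a)) _
  eq_one := by
    have : μ.real (Set.Iic L) = 1 := by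
      rw [measureReal_def, (mem_ae_iff_prob_eq_one measurableSet_Iic).1
        (by filter_upwards [hμ] with x hx using hx.2)]
      simp
    rw [this, sub_eq_neg_add 1 a, hW.add_one]
    abel

end IsCircleChain

/-- For every tolerance, a convex combination of elements of `M` equimeasurable with `T` is close
to the scalar `τ T`. -/
lemma IsCircleChain.exists_mem_convexHull_dist_le {W : ℝ → H →L[ℂ] H} (hW : IsCircleChain M τ W)
    (hτ : IsFaithfulTracialState M τ) {T : H →L[ℂ] H} (hT : T ∈ M) (h0 : 0 ≤ T)
    {m : ℕ} (hm : 0 < m) (k : ℕ) :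
    ∃ A ∈ convexHull ℝ {S | S ∈ M ∧ ∀ n : ℕ, τ (S ^ n) = τ (T ^ n)},
      dist (τ T • (1 : H →L[ℂ] H)) A ≤ 2 * ‖T‖ / m + 2 * (‖T‖ / 2 ^ k) := by
  have hm' : (0 : ℝ) < m := by exact_mod_cast hm
  set L := ‖T‖
  have hL : 0 ≤ L := norm_nonneg T
  obtain ⟨μ, _, hμ, hmom⟩ := hτ.exists_distribution hT h0
  let G : ℕ → ℝ → H →L[ℂ] H := fun j x =>
    W (μ.real (Set.Iic x) - j / m) - W (-(j / m))
  have hG : ∀ j, IsResolution M L (G j) := fun j => hW.isResolution hμ _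
  have hGtr : ∀ j x, τ (G j x) = μ.real (Set.Iic x) := fun j x => by
    simp only [G]
    rw [hτ.map_sub, hW.trace, hW.trace]
    push_cast
    ring
  choose S hSM hSsa hSmom hSdist using fun j => (hG j).exists_spectralIntegral hτ hL hμ (hGtr j)
  let N := 2 ^ k
  have hN : (0 : ℝ) < (N : ℕ) := by positivity
  let F : ℕ → ℝ := fun i => μ.real (Set.Iic (L * i / N))
  let c : ℝ := L - L / N * ∑ i ∈ Finset.range N, F i
  have hc : ∀ j, τ (riemannSum (G j) L N) = c := fun j => by
    rw [riemannSum, hτ.map_sub, hτ.map_real_smul, hτ.map_real_smul, hτ.map_one, hτ.map_sum]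
    simp_rw [hGtr]
    simp only [c, F]
    push_cast
    ring
  let avg : (ℕ → H →L[ℂ] H) → H →L[ℂ] H := fun X => (m : ℝ)⁻¹ • ∑ j ∈ Finset.range m, X j
  have havg : ∀ X : ℕ → H →L[ℂ] H, ∀ r : ℝ, (∀ j, ‖X j‖ ≤ r) → ‖avg X‖ ≤ r := fun X r h => by
    simp only [avg]
    rw [norm_smul, Real.norm_of_nonneg (by positivity), inv_mul_le_iff₀ hm']
    refine (norm_sum_le _ _).trans ((Finset.sum_le_sum fun j _ => h j).trans_eq ?_)
    simp
  refine ⟨avg S, ?_, ?_⟩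
  · simp only [avg]
    rw [Finset.smul_sum]
    refine (convex_convexHull ℝ _).sum_mem (fun _ _ => by positivity)
      (by simp [hm'.ne']) fun j _ => subset_convexHull ℝ _ ⟨hSM j, fun n => ?_⟩
    rw [hSmom, hmom]
  · have h1 : ‖avg (fun j => riemannSum (G j) L N - S j)‖ ≤ L / 2 ^ k :=
      havg _ _ fun j => hSdist j k
    have h2 : ‖τ T • (1 : H →L[ℂ] H) - (c : ℂ) • (1 : H →L[ℂ] H)‖ ≤ L / 2 ^ k := by
      have : τ T = τ (S 0) := by simpa using ((hSmom 0 1).trans (hmom 1).symm).symm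
      rw [this, ← hc 0, ← sub_smul, ← hτ.map_sub, norm_smul]
      calc _ ≤ ‖S 0 - riemannSum (G 0) L N‖ * 1 := by
            gcongr
            · exact hτ.norm_map_le (sub_mem (hSM 0) ((hG 0).riemannSum_mem _))
                ((hSsa 0).sub ((hG 0).isSelfAdjoint_riemannSum _))
            · exact ContinuousLinearMap.norm_id_le
        _ ≤ L / 2 ^ k := by rw [mul_one, norm_sub_rev]; exact hSdist 0 k
    have h3 : ‖(c : ℂ) • (1 : H →L[ℂ] H) - avg (fun j => riemannSum (G j) L N)‖ ≤ 2 * L / m := by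
      have : (c : ℂ) • (1 : H →L[ℂ] H) - avg (fun j => riemannSum (G j) L N)
          = (L / N) • ∑ i ∈ Finset.range N,
            (avg (fun j => G j (L * i / N)) - F i • (1 : H →L[ℂ] H)) := by
        have hconst : (m : ℝ)⁻¹ • ∑ j ∈ Finset.range m, L • (1 : H →L[ℂ] H) = L • 1 := by
          rw [Finset.sum_const, Finset.card_range, ← Nat.cast_smul_eq_nsmul ℝ, smul_smul,
            inv_mul_cancel₀ hm'.ne', one_smul]
        have hcomm : ∑ i ∈ Finset.range N, avg (fun j => G j (L * i / N))
            = (m : ℝ)⁻¹ • ∑ j ∈ Finset.range m, ∑ i ∈ Finset.range N, G j (L * i / N) := by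
          simp only [avg]
          rw [← Finset.smul_sum, Finset.sum_comm]
        rw [Finset.sum_sub_distrib, hcomm, ← Finset.sum_smul]
        simp only [avg, riemannSum]
        rw [Finset.sum_sub_distrib, smul_sub, hconst, ← Finset.smul_sum, Complex.coe_smul]
        simp only [c]
        module
      rw [this, norm_smul, Real.norm_of_nonneg (by positivity)]
      calc _ ≤ L / N * ∑ i ∈ Finset.range N, (2 / m : ℝ) := by
            gcongr
            refine (norm_sum_le _ _).trans (Finset.sum_le_sum fun i _ => ?_)
            exact hW.norm_average_sub_le hm MeasureTheory.measureReal_nonneg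
        _ = 2 * L / m := by
            rw [Finset.sum_const, Finset.card_range, nsmul_eq_mul]
            field_simp
    have h4 : τ T • (1 : H →L[ℂ] H) - avg S
        = (τ T • (1 : H →L[ℂ] H) - (c : ℂ) • (1 : H →L[ℂ] H))
          + ((c : ℂ) • (1 : H →L[ℂ] H) - avg (fun j => riemannSum (G j) L N))
          + avg (fun j => riemannSum (G j) L N - S j) := by
      simp only [avg]
      rw [Finset.sum_sub_distrib, smul_sub]
      abel
    rw [dist_eq_norm, h4]
    refine (norm_add₃_le).trans ?_
    linarith

end WeakDixmier

/-- A diffuse finite von Neumann algebra with a faithful normal tracial state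
(normality is expressed as complete additivity on orthogonal families of projections)
satisfies the weak Dixmier property: for every positive `T ∈ M`, `τ(T)·1` lies in the
operator-norm closure of the convex hull of
`{S ∈ M : τ(Sⁿ) = τ(Tⁿ) for all n}`. -/
theorem stmt_12 {H : Type} [NormedAddCommGroup H] [InnerProductSpace ℂ H] [CompleteSpace H]
    (M : VonNeumannAlgebra H) (τ : (H →L[ℂ] H) → ℂ) (hτ : IsFaithfulTracialState M τ)
    (hnormal : ∀ {ι : Type} (P : ι → (H →L[ℂ] H)) (Q : H →L[ℂ] H),
      (∀ i, P i ∈ M ∧ IsSelfAdjoint (P i) ∧ P i * P i = P i) →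
      Q ∈ M → IsSelfAdjoint Q → Q * Q = Q →
      (∀ i j, i ≠ j → P i * P j = 0) →
      (∀ x : H, HasSum (fun i => P i x) (Q x)) →
      HasSum (fun i => τ (P i)) (τ Q))
    (hdiffuse : ∀ P ∈ M, IsSelfAdjoint P → P * P = P → P ≠ 0 →
      ∃ Q ∈ M, IsSelfAdjoint Q ∧ Q * Q = Q ∧ Q ≠ 0 ∧ Q ≠ P ∧ Q ≤ P)
    (T : H →L[ℂ] H) (hT : T ∈ M) (hTpos : 0 ≤ T) :
    τ T • (1 : H →L[ℂ] H) ∈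
      closure (convexHull ℝ {S | S ∈ M ∧ ∀ n : ℕ, τ (S ^ n) = τ (T ^ n)}) := by
  obtain ⟨W, hW⟩ := hτ.exists_isCircleChain hnormal hdiffuse
  refine Metric.mem_closure_iff.2 fun ε hε => ?_
  have h1 : Tendsto (fun m : ℕ => 2 * ‖T‖ / (m : ℝ)) atTop (𝓝 0) :=
    tendsto_const_nhds.div_atTop tendsto_natCast_atTop_atTop
  have h2 : Tendsto (fun k : ℕ => 2 * (‖T‖ / 2 ^ k)) atTop (𝓝 0) := by
    simpa using (tendsto_const_nhds.div_atTop
      (tendsto_pow_atTop_atTop_of_one_lt (one_lt_two (α := ℝ)))).const_mul 2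
  obtain ⟨m, hm, hm0⟩ := ((h1.eventually_lt_const (half_pos hε)).and (eventually_gt_atTop 0)).exists
  obtain ⟨k, hk⟩ := (h2.eventually_lt_const (half_pos hε)).exists
  obtain ⟨A, hA, hdist⟩ := hW.exists_mem_convexHull_dist_le hτ hT hTpos hm0 k
  exact ⟨A, hA, by linarith⟩
end
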